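/- Let X be a nonempty set. Every oriented X-graph G admits an injective hull: there exists an injective oriented X-graph Q and a monomorphism i : G → Q which is essential, meaning that every morphism h : Q → H for which h ∘ i is a monomorphism is itself a monomorphism. (Concretely, for non-initial G one may take Q(V) = G(V) and Q(A) = G(A) ⊔ {f : X → G(V) | f is not the incidence of any arc of G}; the injective hull of the initial object is the terminal object.) -/

import Mathlib

open CategoryTheory

variable (X : Type)

/-- An oriented `X`-graph: a set of vertices, a set of arcs, and a parametrized
incidence map `∂ : A → V^X` (the `x`-incidence of an arc `a` is `inc a x`). -/
structure OGraph : Type 1 where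
  V : Type
  A : Type
  inc : A → X → V

variable {X}

/-- Morphisms of oriented `X`-graphs: pairs of maps preserving the incidences. -/
@[ext]
structure OGHom (G H : OGraph X) where
  fV : G.V → H.V
  fA : G.A → H.A
  compat : ∀ a x, H.inc (fA a) x = fV (G.inc a x)

instance : Category (OGraph X) where
  Hom := OGHom
  id G := ⟨id, id, fun a x => rfl⟩
  comp f g := ⟨g.fV ∘ f.fV, g.fA ∘ f.fA, fun a x => by
    simp [g.compat, f.compat]⟩
  id_comp f := rfl
  comp_id f := rfl
  assoc f g h := rfl

namespace OGraph

theorem hom_ext {G H : OGraph X} {f g : G ⟶ H} (hV : f.fV = g.fV) (hA : f.fA = g.fA) : f = g :=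
  OGHom.ext hV hA

theorem hom_compat {G H : OGraph X} (f : G ⟶ H) (a : G.A) : H.inc (f.fA a) = f.fV ∘ G.inc a :=
  funext (f.compat a)

/-- The graph with a single vertex and no arcs. -/
def point (X : Type) : OGraph X := ⟨Unit, Empty, fun a _ => a.elim⟩

/-- The morphism from the one-vertex graph which selects a vertex. -/
def pointHom {G : OGraph X} (v : G.V) : point X ⟶ G where
  fV _ := v
  fA a := a.elim
  compat a := a.elim

/-- The graph with vertex set `X` and a single arc, whose incidence is the identity. -/
def arrow (X : Type) : OGraph X := ⟨X, Unit, fun _ x => x⟩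

/-- The morphism from the one-arc graph which selects an arc. -/
def arrowHom {G : OGraph X} (a : G.A) : arrow X ⟶ G where
  fV := G.inc a
  fA _ := a
  compat _ _ := rfl

theorem mono_iff_injective {G H : OGraph X} (f : G ⟶ H) :
    Mono f ↔ Function.Injective f.fV ∧ Function.Injective f.fA := by
  refine ⟨fun _ => ⟨fun u v huv => ?_, fun a b hab => ?_⟩, fun ⟨hV, hA⟩ => ⟨fun g h e => ?_⟩⟩
  · have e : pointHom u ≫ f = pointHom v ≫ f :=
      hom_ext (funext fun _ => huv) (funext fun a => a.elim)
    exact congrFun (congrArg OGHom.fV ((cancel_mono f).1 e)) ()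
  · have e : arrowHom a ≫ f = arrowHom b ≫ f := by
      refine hom_ext ?_ (funext fun _ => hab)
      change f.fV ∘ G.inc a = f.fV ∘ G.inc b
      rw [← hom_compat, ← hom_compat, hab]
    exact congrFun (congrArg OGHom.fA ((cancel_mono f).1 e)) ()
  · exact hom_ext (hV.comp_left (congrArg OGHom.fV e)) (hA.comp_left (congrArg OGHom.fA e))

/-- A graph with a vertex in which every `X`-tuple of vertices is the incidence of an arc is
injective. -/
theorem injective_of_surjective_inc (Q : OGraph X) [Nonempty Q.V]
    (hQ : Function.Surjective Q.inc) : Injective Q where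
  factors {G H} g m hm := by
    obtain ⟨hV, hA⟩ := (mono_iff_injective m).1 hm
    choose s hs using hQ
    let k : H.V → Q.V := Function.extend m.fV g.fV fun _ => Classical.arbitrary Q.V
    have hk : k ∘ m.fV = g.fV := Function.extend_comp hV _ _
    let l : H.A → Q.A := Function.extend m.fA g.fA fun b => s (k ∘ H.inc b)
    have hl : l ∘ m.fA = g.fA := Function.extend_comp hA _ _
    refine ⟨⟨k, l, fun b => congrFun (?_ : Q.inc (l b) = k ∘ H.inc b)⟩, hom_ext hk hl⟩
    by_cases hb : ∃ a, m.fA a = b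
    · obtain ⟨a, rfl⟩ := hb
      rw [← Function.comp_apply (f := l), hl, hom_compat, hom_compat, ← Function.comp_assoc, hk]
    · rw [show l b = s (k ∘ H.inc b) from Function.extend_apply' _ _ _ hb, hs]

/-- The graph obtained by adding one arc for every `X`-tuple of vertices which is not the
incidence of an arc. -/
def completion (G : OGraph X) : OGraph X where
  V := G.V
  A := G.A ⊕ {f : X → G.V // f ∉ Set.range G.inc}
  inc := Sum.elim G.inc Subtype.val

/-- The inclusion of a graph into its completion. -/
def toCompletion (G : OGraph X) : G ⟶ G.completion where
  fV := id
  fA := Sum.inl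
  compat _ _ := rfl

theorem surjective_completion_inc (G : OGraph X) : Function.Surjective G.completion.inc := by
  intro f
  by_cases hf : f ∈ Set.range G.inc
  · obtain ⟨a, rfl⟩ := hf
    exact ⟨Sum.inl a, rfl⟩
  · exact ⟨Sum.inr ⟨f, hf⟩, rfl⟩

instance mono_toCompletion (G : OGraph X) : Mono G.toCompletion :=
  (mono_iff_injective _).2 ⟨Function.injective_id, Sum.inl_injective⟩

theorem mono_of_mono_toCompletion_comp {G H : OGraph X} (h : G.completion ⟶ H)
    (hm : Mono (G.toCompletion ≫ h)) : Mono h := by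
  obtain ⟨hV, hA⟩ := (mono_iff_injective _).1 hm
  replace hV : Function.Injective h.fV := hV
  refine (mono_iff_injective h).2 ⟨hV, fun a b hab => ?_⟩
  have e : G.completion.inc a = G.completion.inc b := by
    apply hV.comp_left
    change h.fV ∘ _ = h.fV ∘ _
    rw [← hom_compat, ← hom_compat, hab]
  match a, b, hab, e with
  | .inl a, .inl b, hab, _ => exact congrArg Sum.inl (hA hab)
  | .inl a, .inr f, _, e => exact (f.2 ⟨a, e⟩).elim
  | .inr f, .inl b, _, e => exact (f.2 ⟨b, e.symm⟩).elim
  | .inr f, .inr g, _, e => exact congrArg Sum.inr (Subtype.ext e)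

/-- The graph with a single vertex and a single arc. -/
def terminal (X : Type) : OGraph X := ⟨Unit, Unit, fun _ _ => ()⟩

end OGraph

/-- For a nonempty set `X`, every oriented `X`-graph admits an
injective hull: an essential monomorphism into an injective object. -/
theorem ographs_injective_hull (X : Type) [Nonempty X] (G : OGraph X) :
    ∃ (Q : OGraph X) (i : G ⟶ Q), Injective Q ∧ Mono i ∧
      ∀ (H : OGraph X) (h : Q ⟶ H), Mono (i ≫ h) → Mono h := by
  rcases isEmpty_or_nonempty G.V with hV | hV
  · have hA : IsEmpty G.A := ⟨fun a => hV.elim (G.inc a (Classical.arbitrary X))⟩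
    have : Nonempty (OGraph.terminal X).V := ⟨()⟩
    refine ⟨OGraph.terminal X, ⟨fun _ => (), fun _ => (), fun _ _ => rfl⟩,
      OGraph.injective_of_surjective_inc _ fun f => ⟨(), rfl⟩,
      (OGraph.mono_iff_injective _).2
        ⟨Function.injective_of_subsingleton _, Function.injective_of_subsingleton _⟩,
      fun H h _ => (OGraph.mono_iff_injective _).2 ⟨fun _ _ _ => rfl, fun _ _ _ => rfl⟩⟩
  · have : Nonempty G.completion.V := hV
    exact ⟨G.completion, G.toCompletion,
      OGraph.injective_of_surjective_inc _ G.surjective_completion_inc,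
      G.mono_toCompletion, fun _ => OGraph.mono_of_mono_toCompletion_comp⟩
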